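/- (Theorem 2 combined with uniqueness of the root) Let α > 0 and let p* be the unique solution in (0,1) of 1/p = (α/K)·log( p(L−1)/(1−p) ). If F is a feasible prediction profile with F^k_j ∈ (0,1) for all k, j that is a local minimizer of F ↦ L_ECE(F) − α·H(F_en) on the set of feasible prediction profiles, then F^k_y = F_en_y = p* for every k ∈ {1,…,K}, and F_en_j = (1 − p*)/(L − 1) for every j ≠ y. -/

import Mathlib

noncomputable section

/-- A feasible prediction profile: `K` probability vectors over `L` classes. -/
def Feasible (K L : ℕ) (F : Fin K → Fin L → ℝ) : Prop :=
  (∀ k j, 0 ≤ F k j) ∧ ∀ k, ∑ j, F k j = 1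

/-- The ensemble cross-entropy loss `L_ECE(F) = −∑_k log F^k_y`. -/
def LECE (K L : ℕ) (y : Fin L) (F : Fin K → Fin L → ℝ) : ℝ :=
  - ∑ k, Real.log (F k y)

/-- The ensemble prediction `F_en = (1/K) ∑_k F^k`. -/
def Fen (K L : ℕ) (F : Fin K → Fin L → ℝ) : Fin L → ℝ :=
  fun j => (∑ k, F k j) / (K : ℝ)

/-- The Shannon entropy `H(v) = −∑_j v_j log v_j`. -/
def Hen (L : ℕ) (v : Fin L → ℝ) : ℝ :=
  - ∑ j, v j * Real.log (v j)

open Filter Topology in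
/-- Moving an interior profile by a small multiple of a direction whose rows sum to zero keeps it
feasible. -/
lemma eventually_feasible_add_smul {K L : ℕ} {F D : Fin K → Fin L → ℝ} (hF : Feasible K L F)
    (hpos : ∀ k j, 0 < F k j) (hD : ∀ k, ∑ j, D k j = 0) :
    ∀ᶠ t : ℝ in 𝓝 0, Feasible K L (F + t • D) := by
  have hev : ∀ k j, ∀ᶠ t : ℝ in 𝓝 0, 0 < (F + t • D) k j := fun k j => by
    have hc : Continuous fun t : ℝ => (F + t • D) k j := by
      simp only [Pi.add_apply, Pi.smul_apply, smul_eq_mul]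
      fun_prop
    exact hc.continuousAt.eventually (lt_mem_nhds (by simpa using hpos k j))
  filter_upwards [eventually_all.2 fun k => eventually_all.2 (hev k)] with t ht
  refine ⟨fun k j => (ht k j).le, fun k => ?_⟩
  simp [Finset.sum_add_distrib, ← Finset.mul_sum, hF.2 k, hD k]

/-- The directional derivative of `LECE − α·H(Fen)`. -/
lemma hasDerivAt_objective {K L : ℕ} (y : Fin L) (α : ℝ) {F : Fin K → Fin L → ℝ}
    (D : Fin K → Fin L → ℝ) (hy : ∀ k, F k y ≠ 0) (hen : ∀ j, Fen K L F j ≠ 0) :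
    HasDerivAt (fun t : ℝ => LECE K L y (F + t • D) - α * Hen L (Fen K L (F + t • D)))
      (-(∑ k, D k y / F k y) + α * ∑ j, (Real.log (Fen K L F j) + 1) * Fen K L D j) 0 := by
  have hline : ∀ k j, HasDerivAt (fun t : ℝ => (F + t • D) k j) (D k j) 0 := fun k j => by
    simpa using ((hasDerivAt_id (0 : ℝ)).mul_const (D k j)).const_add (F k j)
  have hFen : ∀ j, HasDerivAt (fun t : ℝ => Fen K L (F + t • D) j) (Fen K L D j) 0 := fun j =>
    (HasDerivAt.fun_sum fun k _ => hline k j).div_const _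
  have hlog : HasDerivAt (fun t : ℝ => LECE K L y (F + t • D)) (-(∑ k, D k y / F k y)) 0 := by
    refine (HasDerivAt.fun_sum fun k _ => ?_).neg
    simpa using (hline k y).log (by simpa using hy k)
  have hent : HasDerivAt (fun t : ℝ => Hen L (Fen K L (F + t • D)))
      (-∑ j, (Real.log (Fen K L F j) + 1) * Fen K L D j) 0 := by
    refine (HasDerivAt.fun_sum fun j _ => ?_).neg
    have h := Real.hasDerivAt_mul_log (x := Fen K L (F + (0 : ℝ) • D) j) (by simpa using hen j)
    simpa [Function.comp_def] using h.comp (0 : ℝ) (hFen j)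
  exact (hlog.sub (hent.const_mul α)).congr_deriv (by ring)

/-- First-order condition: the directional derivative vanishes at an interior local minimizer along
every direction whose rows sum to zero. -/
lemma first_order_condition {K L : ℕ} {y : Fin L} {α : ℝ} {F D : Fin K → Fin L → ℝ}
    (hF : Feasible K L F) (hpos : ∀ k j, 0 < F k j) (hen : ∀ j, Fen K L F j ≠ 0)
    (hmin : IsLocalMinOn (fun G => LECE K L y G - α * Hen L (Fen K L G))
      {G | Feasible K L G} F) (hD : ∀ k, ∑ j, D k j = 0) :
    -(∑ k, D k y / F k y) + α * ∑ j, (Real.log (Fen K L F j) + 1) * Fen K L D j = 0 := by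
  refine IsLocalMin.hasDerivAt_eq_zero ?_
    (hasDerivAt_objective y α D (fun k => (hpos k y).ne') hen)
  have hcont : Continuous fun t : ℝ => F + t • D := by fun_prop
  have htend : Filter.Tendsto (fun t : ℝ => F + t • D) (nhds 0)
      (nhdsWithin F {G | Feasible K L G}) :=
    tendsto_nhdsWithin_iff.2
      ⟨by simpa using hcont.tendsto 0, eventually_feasible_add_smul hF hpos hD⟩
  filter_upwards [htend.eventually hmin] with t ht
  simpa using ht

/-- First-order condition for transferring mass from class `b` to class `a` in member `k`. -/
lemma exchange_condition {K L : ℕ} {y : Fin L} {α : ℝ} {F : Fin K → Fin L → ℝ}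
    (hF : Feasible K L F) (hpos : ∀ k j, 0 < F k j) (hen : ∀ j, Fen K L F j ≠ 0)
    (hmin : IsLocalMinOn (fun G => LECE K L y G - α * Hen L (Fen K L G))
      {G | Feasible K L G} F) (k : Fin K) (a b : Fin L) (hb : b ≠ y) :
    (if a = y then 1 / F k y else 0) =
      (α / K) * (Real.log (Fen K L F a) - Real.log (Fen K L F b)) := by
  have h := first_order_condition (D := fun k' j =>
    if k' = k then (if j = a then 1 else 0) - (if j = b then 1 else 0) else 0) hF hpos hen hmin
    (fun k' => by by_cases hk : k' = k <;> simp [hk])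
  have hsum : ∑ j, (Real.log (Fen K L F j) + 1) * Fen K L (fun k' j =>
      if k' = k then (if j = a then 1 else 0) - (if j = b then 1 else 0) else 0) j =
      (Real.log (Fen K L F a) - Real.log (Fen K L F b)) / K := by
    have hterm : ∀ j, (Real.log (Fen K L F j) + 1) * Fen K L (fun k' j =>
        if k' = k then (if j = a then 1 else 0) - (if j = b then 1 else 0) else 0) j =
        (if j = a then (Real.log (Fen K L F j) + 1) / K else 0) -
          (if j = b then (Real.log (Fen K L F j) + 1) / K else 0) := fun j => by
      simp only [Fen, Finset.sum_ite_eq', Finset.mem_univ, if_true]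
      split_ifs <;> ring
    simp only [hterm, Finset.sum_sub_distrib, Finset.sum_ite_eq', Finset.mem_univ, if_true]
    ring
  have hfirst : ∑ k', (if k' = k then ((if y = a then 1 else 0) - (if y = b then 1 else 0) : ℝ)
      else 0) / F k' y = if a = y then 1 / F k y else 0 := by
    simp [ite_div, hb.symm, eq_comm (a := y)]
  rw [hsum, hfirst] at h
  linear_combination -h

lemma sum_Fen {K L : ℕ} (hK : 1 ≤ K) {F : Fin K → Fin L → ℝ} (hF : Feasible K L F) :
    ∑ j, Fen K L F j = 1 := by
  have hK0 : (K : ℝ) ≠ 0 := by positivity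
  simp only [Fen, ← Finset.sum_div]
  rw [Finset.sum_comm]
  simp [hF.2, hK0]

/-- **Theorem 2 combined with uniqueness of the root of Eq. (2)**: if `p*` is the unique
solution in `(0,1)` of `1/p = (α/K)·log( p(L−1)/(1−p) )`, then any interior local
minimizer of `F ↦ L_ECE(F) − α·H(F_en)` on the feasible set satisfies
`F^k_y = F_en_y = p*` for every `k`, and `F_en_j = (1 − p*)/(L − 1)` for every `j ≠ y`. -/
theorem adp_entropy_only_optima_root (K L : ℕ) (hK : 1 ≤ K) (hL : 2 ≤ L) (y : Fin L)
    (α : ℝ) (hα : 0 < α)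
    (p : ℝ) (hp : p ∈ Set.Ioo (0 : ℝ) 1)
    (hpeq : 1 / p = (α / K) * Real.log (p * ((L : ℝ) - 1) / (1 - p)))
    (hpuniq : ∀ q ∈ Set.Ioo (0 : ℝ) 1,
      1 / q = (α / K) * Real.log (q * ((L : ℝ) - 1) / (1 - q)) → q = p)
    (F : Fin K → Fin L → ℝ) (hF : Feasible K L F)
    (hFo : ∀ k j, F k j ∈ Set.Ioo (0 : ℝ) 1)
    (hmin : IsLocalMinOn (fun G => LECE K L y G - α * Hen L (Fen K L G))
      {G | Feasible K L G} F) :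
    (∀ k, F k y = p) ∧
    Fen K L F y = p ∧
    (∀ j, j ≠ y → Fen K L F j = (1 - p) / ((L : ℝ) - 1)) := by
  have hK0 : (K : ℝ) ≠ 0 := by positivity
  have hL1 : (0 : ℝ) < (L : ℝ) - 1 := by
    have : (2 : ℝ) ≤ L := by exact_mod_cast hL
    linarith
  have hpos : ∀ k j, 0 < F k j := fun k j => (hFo k j).1
  have k₀ : Fin K := ⟨0, hK⟩
  have hen : ∀ j, 0 < Fen K L F j := fun j =>
    div_pos (Finset.sum_pos (fun k _ => hpos k j) ⟨k₀, Finset.mem_univ _⟩) (by positivity)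
  have hex := exchange_condition hF hpos (fun j => (hen j).ne') hmin
  have : Nontrivial (Fin L) := Fin.nontrivial_iff_two_le.2 hL
  obtain ⟨j₀, hj₀⟩ := exists_ne y
  have hmember : ∀ k, F k y = F k₀ y := fun k => by
    have h := (hex k y j₀ hj₀).trans (hex k₀ y j₀ hj₀).symm
    simpa using h
  have hFy : Fen K L F y = F k₀ y := by
    simp [Fen, hmember, hK0]
  have hothers : ∀ j, j ≠ y → Fen K L F j = Fen K L F j₀ := fun j hj => by
    have h := hex k₀ j j₀ hj₀
    rw [if_neg hj, eq_comm, mul_eq_zero, or_iff_right (div_ne_zero hα.ne' hK0), sub_eq_zero] at h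
    exact Real.log_injOn_pos (hen j) (hen j₀) h
  have hval : Fen K L F j₀ = (1 - F k₀ y) / ((L : ℝ) - 1) := by
    have h := sum_Fen hK hF
    rw [← Finset.add_sum_erase _ _ (Finset.mem_univ y),
      Finset.sum_congr rfl fun j hj => hothers j (Finset.ne_of_mem_erase hj), hFy] at h
    rw [Finset.sum_const, Finset.card_erase_of_mem (Finset.mem_univ y), Finset.card_univ,
      Fintype.card_fin, nsmul_eq_mul, Nat.cast_sub (by lia), Nat.cast_one] at h
    rw [eq_div_iff hL1.ne']
    linarith
  have hroot : F k₀ y = p := by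
    refine hpuniq _ (hFo k₀ y) ?_
    have h := hex k₀ y j₀ hj₀
    rw [if_pos rfl, ← Real.log_div (hen y).ne' (hen j₀).ne', hFy, hval, div_div_eq_mul_div] at h
    exact h
  exact ⟨fun k => (hmember k).trans hroot, hFy.trans hroot,
    fun j hj => by rw [hothers j hj, hval, hroot]⟩
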